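/- Let P be a d-dimensional k-template (d ≥ 1, k ≥ 2) and let m ≥ d. Then there is an m-dimensional k-template Q such that e(Q) = e(P), P = {x restricted to its first d coordinates : x ∈ Q}, and for every infinite set X, the hypergraph L(X^m,Q) is embeddable into L(X^d,P). -/

import Mathlib

open Cardinal

/-- A hypergraph with vertex type `V` is identified with its set of edges
`E : Set (Set V)`.  It is `κ`-colorable if there is a function from `V` to a
set of cardinality at most `κ` that is not constant on any edge. -/
def HGColorable {V : Type} (E : Set (Set V)) (κ : Cardinal) : Prop :=
  ∃ (α : Type) (φ : V → α), #α ≤ κ ∧ ∀ e ∈ E, ∃ x ∈ e, ∃ y ∈ e, φ x ≠ φ y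

/-- The chromatic number of a hypergraph: the least cardinal `κ` such that it
has a proper `κ`-coloring. -/
noncomputable def chrNum {V : Type} (E : Set (Set V)) : Cardinal :=
  sInf {κ | HGColorable E κ}

/-- `cardSucc κ m = κ^{+m}`, the `m`-fold cardinal successor of `κ`. -/
noncomputable def cardSucc (κ : Cardinal) (m : ℕ) : Cardinal := (Order.succ)^[m] κ

/-- `Q` is a homomorphic image of the set `P` of `d`-tuples: there is a
surjection `f : P → Q` such that `x i = y i` implies `f x i = f y i`. -/
def IsHomImage {d : ℕ} {A : Type} {B : Fin d → Type} (P : Set (Fin d → A))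
    (Q : Set (∀ i, B i)) : Prop :=
  ∃ f : (Fin d → A) → (∀ i, B i),
    Set.MapsTo f P Q ∧ Set.SurjOn f P Q ∧
    ∀ x ∈ P, ∀ y ∈ P, ∀ i, x i = y i → f x i = f y i

/-- The edges of the template hypergraph `L(X, P)` where `X = Π i, B i`:
the `k`-element subsets of the vertex set that are homomorphic images of `P`. -/
def templateEdges (k : ℕ) {d : ℕ} {A : Type} {B : Fin d → Type}
    (P : Set (Fin d → A)) : Set (Set (∀ i, B i)) :=
  {Q | Q.ncard = k ∧ IsHomImage P Q}

/-- `I` is a distinguisher for `P`: any two distinct members of `P` differ at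
some coordinate in `I`. -/
def IsDistinguisher {d : ℕ} {A : Type} (P : Set (Fin d → A)) (I : Finset (Fin d)) : Prop :=
  ∀ x ∈ P, ∀ y ∈ P, x ≠ y → ∃ i ∈ I, x i ≠ y i

/-- `eDim P = e(P)`, the least cardinality of a distinguisher for `P`. -/
noncomputable def eDim {d : ℕ} {A : Type} (P : Set (Fin d → A)) : ℕ :=
  sInf {e | ∃ I : Finset (Fin d), IsDistinguisher P I ∧ I.card = e}

/-- A `d`-dimensional template is simple if for every `m < d` there are
`x, y ∈ P` with `x i = y i` exactly when `i ≠ m`. -/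
def IsSimple {d : ℕ} {A : Type} (P : Set (Fin d → A)) : Prop :=
  ∀ m : Fin d, ∃ x ∈ P, ∃ y ∈ P, ∀ i, (x i = y i ↔ i ≠ m)

/-- The edges of the zero hypergraph of a `(k, n)`-ary real polynomial:
`k`-element subsets `{a_0, …, a_{k-1}}` of `ℝⁿ` with `p(a_0, …, a_{k-1}) = 0`
for some ordering of the elements. -/
def zeroEdges {n k : ℕ} (p : MvPolynomial (Fin k × Fin n) ℝ) :
    Set (Set (Fin n → ℝ)) :=
  {A | ∃ a : Fin k → (Fin n → ℝ), Function.Injective a ∧ A = Set.range a ∧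
        MvPolynomial.eval (fun q => a q.1 q.2) p = 0}

/-- `H₂ = (V₂, E₂)` contains (a copy of) `H₁ = (V₁, E₁)`: some injection
`V₁ → V₂` maps every edge of `H₁` onto an edge of `H₂`. -/
def HGContains {V₁ V₂ : Type} (E₁ : Set (Set V₁)) (E₂ : Set (Set V₂)) : Prop :=
  ∃ f : V₁ → V₂, Function.Injective f ∧ ∀ e ∈ E₁, f '' e ∈ E₂

theorem IsDistinguisher.eDim_le {d : ℕ} {A : Type} {P : Set (Fin d → A)} {I : Finset (Fin d)}
    (h : IsDistinguisher P I) : eDim P ≤ I.card :=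
  Nat.sInf_le ⟨I, h, rfl⟩

theorem exists_isDistinguisher_card_eq_eDim {d : ℕ} {A : Type} (P : Set (Fin d → A)) :
    ∃ I : Finset (Fin d), IsDistinguisher P I ∧ I.card = eDim P := by
  have huniv : IsDistinguisher P Finset.univ := fun x _ y _ hxy => by
    obtain ⟨i, hi⟩ := Function.ne_iff.mp hxy
    exact ⟨i, Finset.mem_univ i, hi⟩
  exact Nat.sInf_mem
    (s := {e | ∃ I : Finset (Fin d), IsDistinguisher P I ∧ I.card = e}) ⟨_, _, huniv, rfl⟩

/-- Repeating coordinates along a map `r` with a right inverse does not change `eDim`. -/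
theorem eDim_image_comp {d m : ℕ} {A : Type} (P : Set (Fin d → A)) {r : Fin m → Fin d}
    {s : Fin d → Fin m} (hrs : Function.LeftInverse r s) :
    eDim ((fun x : Fin d → A => x ∘ r) '' P) = eDim P := by
  apply le_antisymm
  · obtain ⟨I, hI, hcard⟩ := exists_isDistinguisher_card_eq_eDim P
    rw [← hcard]
    refine le_trans (IsDistinguisher.eDim_le (I := I.image s) ?_) Finset.card_image_le
    rintro _ ⟨x, hx, rfl⟩ _ ⟨y, hy, rfl⟩ hxy
    obtain ⟨i, hi, hne⟩ := hI x hx y hy fun h => hxy (by rw [h])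
    exact ⟨s i, Finset.mem_image_of_mem s hi, by simpa [hrs i] using hne⟩
  · obtain ⟨I, hI, hcard⟩ := exists_isDistinguisher_card_eq_eDim ((fun x : Fin d → A => x ∘ r) '' P)
    rw [← hcard]
    refine le_trans (IsDistinguisher.eDim_le (I := I.image r) ?_) Finset.card_image_le
    intro x hx y hy hxy
    obtain ⟨i, hi, hne⟩ := hI _ ⟨x, hx, rfl⟩ _ ⟨y, hy, rfl⟩
      fun h => hxy (hrs.surjective.injective_comp_right h)
    exact ⟨r i, Finset.mem_image_of_mem r hi, hne⟩

theorem nonempty_embedding_fin_fun (m : ℕ) (X : Type) [Infinite X] :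
    Nonempty ((Fin m → X) ↪ X) := by
  rw [← Cardinal.le_def]
  simpa using Cardinal.power_nat_le (n := m) (Cardinal.aleph0_le_mk X)

/-- Over an infinite set, the template hypergraph obtained by repeating coordinates embeds into
the original one: code together all coordinates lying over the same index. -/
theorem hgContains_templateEdges_image_comp (k : ℕ) {d m : ℕ} {A : Type} (P : Set (Fin d → A))
    (r : Fin m → Fin d) (X : Type) [Infinite X] :
    HGContains
      (templateEdges k (B := fun _ : Fin m => X) ((fun x : Fin d → A => x ∘ r) '' P))
      (templateEdges k (B := fun _ : Fin d => X) P) := by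
  obtain ⟨g⟩ := nonempty_embedding_fin_fun m X
  obtain ⟨x₀⟩ : Nonempty X := inferInstance
  have hinj : Function.Injective
      (fun (y : Fin m → X) (i : Fin d) => g fun j => if r j = i then y j else x₀) := by
    intro y z hyz
    funext j
    simpa using congrFun (g.injective (congrFun hyz (r j))) j
  refine ⟨_, hinj, ?_⟩
  rintro e ⟨hcard, h, hmaps, hsurj, hcongr⟩
  refine ⟨by rw [Set.ncard_image_of_injective _ hinj, hcard],
    fun x i => g fun j => if r j = i then h (x ∘ r) j else x₀, ?_, ?_, ?_⟩
  · exact fun x hx => ⟨h (x ∘ r), hmaps ⟨x, hx, rfl⟩, rfl⟩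
  · rintro _ ⟨y, hy, rfl⟩
    obtain ⟨_, ⟨x, hx, rfl⟩, rfl⟩ := hsurj hy
    exact ⟨x, hx, rfl⟩
  · intro x hx y hy i hxy
    refine congrArg g (funext fun j => ?_)
    split_ifs with hj
    · exact hcongr _ ⟨x, hx, rfl⟩ _ ⟨y, hy, rfl⟩ j (by simpa [hj] using hxy)
    · rfl

/-- Lemma 1.10: for any `d`-dimensional `k`-template `P` and
`m ≥ d`, there is an `m`-dimensional `k`-template `Q` with `e(Q) = e(P)`, whose
restriction to the first `d` coordinates is exactly `P`, and such that for every
infinite set `X`, `L(X^m, Q)` embeds into `L(X^d, P)`. -/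
theorem statement15 (d k m : ℕ) (hd : 1 ≤ d) (hk : 2 ≤ k) (hm : d ≤ m)
    (A : Type) (P : Set (Fin d → A)) (hP : P.ncard = k) :
    ∃ Q : Set (Fin m → A), Q.ncard = k ∧ eDim Q = eDim P ∧
      P = (fun x : Fin m → A => fun i : Fin d => x (Fin.castLE hm i)) '' Q ∧
      ∀ X : Type, Infinite X →
        HGContains (templateEdges k (B := fun _ : Fin m => X) Q)
          (templateEdges k (B := fun _ : Fin d => X) P) := by
  let r : Fin m → Fin d := fun j => if h : (j : ℕ) < d then ⟨j, h⟩ else ⟨0, hd⟩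
  have hrs : Function.LeftInverse r (Fin.castLE hm) := fun i => by simp [r]
  refine ⟨(fun x : Fin d → A => x ∘ r) '' P, ?_, eDim_image_comp P hrs, ?_,
    fun X _ => hgContains_templateEdges_image_comp k P r X⟩
  · rw [Set.ncard_image_of_injective _ hrs.surjective.injective_comp_right, hP]
  · simp [Set.image_image, hrs _]
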